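/- Let f: [0,1] → [0,1] be a trade-off function (convex, non-increasing, f(α) ≤ 1-α) with inf{x ∈ [0,1] : f(x) = 0} = 1, and suppose f = T(U,V). Then the Rényi divergence of order λ > 1 between U and V satisfies D^λ(U‖V) ≤ (1/(λ-1)) log ∫₀¹ |f'(x)|^{1-λ} dx. -/

import Mathlib

open MeasureTheory Set

noncomputable def tradeOff {Ω : Type*} [MeasurableSpace Ω] (U V : Measure Ω) (α : ℝ) : ℝ :=
  sInf { β : ℝ | ∃ φ : Ω → ℝ, Measurable φ ∧ (∀ x, 0 ≤ φ x ∧ φ x ≤ 1) ∧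
    (∫ x, φ x ∂U) ≤ α ∧ β = 1 - ∫ x, φ x ∂V }

noncomputable def renyiDiv {Ω : Type*} [MeasurableSpace Ω] (l : ℝ) (U V : Measure Ω) : ℝ :=
  (l - 1)⁻¹ * Real.log (∫ x, ((U.rnDeriv V x).toReal) ^ l ∂V)

lemma lintegral_Ioi_rpow_mul_ofReal_sub {s c : ℝ} (hs : 0 < s) (hc : 0 < c) :
    ∫⁻ t in Ioi (0 : ℝ), ENNReal.ofReal (s * (s + 1) * t ^ (-s - 2)) * ENNReal.ofReal (t - c) =
      ENNReal.ofReal (c ^ (-s)) := by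
  have hsub : ∫⁻ t in Ioi (0 : ℝ),
        ENNReal.ofReal (s * (s + 1) * t ^ (-s - 2)) * ENNReal.ofReal (t - c) =
      ∫⁻ t in Ioi c, ENNReal.ofReal (s * (s + 1) * (t ^ (-s - 1) - c * t ^ (-s - 2))) := by
    rw [← lintegral_indicator measurableSet_Ioi, ← lintegral_indicator measurableSet_Ioi]
    refine lintegral_congr fun t => ?_
    rcases lt_or_ge c t with ht | ht
    · have ht0 : 0 < t := hc.trans ht
      rw [indicator_of_mem (mem_Ioi.2 ht0), indicator_of_mem (mem_Ioi.2 ht),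
        ← ENNReal.ofReal_mul (by positivity), show -s - 1 = (-s - 2) + 1 by ring,
        Real.rpow_add_one ht0.ne']
      congr 1
      ring
    · rw [indicator_of_notMem (s := Ioi c) (by simpa using ht)]
      simp [indicator, ENNReal.ofReal_of_nonpos (sub_nonpos.2 ht)]
  have h1 : IntegrableOn (fun t : ℝ => t ^ (-s - 1)) (Ioi c) :=
    integrableOn_Ioi_rpow_of_lt (by linarith) hc
  have h2 : IntegrableOn (fun t : ℝ => t ^ (-s - 2)) (Ioi c) :=
    integrableOn_Ioi_rpow_of_lt (by linarith) hc
  have hint : IntegrableOn (fun t : ℝ => s * (s + 1) * (t ^ (-s - 1) - c * t ^ (-s - 2)))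
      (Ioi c) := (h1.sub (h2.const_mul c)).const_mul _
  rw [hsub, ← ofReal_integral_eq_lintegral_ofReal hint]
  · congr 1
    rw [integral_const_mul, integral_sub h1 (h2.const_mul c), integral_const_mul,
      integral_Ioi_rpow_of_lt (by linarith) hc, integral_Ioi_rpow_of_lt (by linarith) hc,
      show -s - 1 + 1 = -s by ring, show -s - 2 + 1 = -s - 1 by ring, Real.rpow_sub_one hc.ne']
    have : -s - 1 ≠ 0 := by linarith
    have : s + 1 ≠ 0 := by linarith
    field_simp
    ring
  · filter_upwards [ae_restrict_mem measurableSet_Ioi] with t ht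
    have ht0 : 0 < t := hc.trans ht
    have : 0 ≤ (t - c) * t ^ (-s - 2) := mul_nonneg (sub_nonneg.2 (le_of_lt ht)) (by positivity)
    rw [show -s - 1 = (-s - 2) + 1 by ring, Real.rpow_add_one ht0.ne']
    have : 0 ≤ s * (s + 1) * ((t - c) * t ^ (-s - 2)) := by positivity
    simp only [Pi.zero_apply]
    linarith

lemma ConvexOn.deriv_mul_sub_le {S : Set ℝ} {f : ℝ → ℝ} (hf : ConvexOn ℝ S f) {x y : ℝ}
    (hx : x ∈ S) (hy : y ∈ S) (hd : DifferentiableAt ℝ f x) :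
    deriv f x * (y - x) ≤ f y - f x := by
  rcases lt_trichotomy x y with h | rfl | h
  · have := hf.deriv_le_slope hx hy h hd
    rwa [slope_def_field, le_div_iff₀ (by linarith)] at this
  · simp
  · have := hf.slope_le_deriv hy hx h hd
    rw [slope_def_field, div_le_iff₀ (by linarith)] at this
    linarith

lemma ConvexOn.absolutelyContinuousOnInterval_of_antitoneOn {f : ℝ → ℝ}
    (hconv : ConvexOn ℝ (Icc (0 : ℝ) 1) f) (hanti : AntitoneOn f (Icc (0 : ℝ) 1))
    {a : ℝ} (ha : 0 < a) (ha1 : a ≤ 1) : AbsolutelyContinuousOnInterval f a 1 := by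
  have hp : a / 2 ∈ Icc (0 : ℝ) 1 := ⟨by linarith, by linarith⟩
  have h1 : (1 : ℝ) ∈ Icc (0 : ℝ) 1 := by simp
  have hM : 0 ≤ f (a / 2) - f 1 := sub_nonneg.2 (hanti hp h1 hp.2)
  set K := (f (a / 2) - f 1) / (a / 2) with hK
  have hK0 : 0 ≤ K := by positivity
  refine LipschitzOnWith.absolutelyContinuousOnInterval (K := K.toNNReal) ?_
  rw [uIcc_of_le ha1]
  refine LipschitzOnWith.of_le_add_mul' K fun x hx y hy => ?_
  have hx' : x ∈ Icc (0 : ℝ) 1 := ⟨ha.le.trans hx.1, hx.2⟩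
  have hy' : y ∈ Icc (0 : ℝ) 1 := ⟨ha.le.trans hy.1, hy.2⟩
  rcases le_or_gt y x with h | h
  · have := hanti hy' hx' h
    have := mul_nonneg hK0 (dist_nonneg (x := x) (y := y))
    linarith
  · have hpx : a / 2 < x := by linarith [hx.1]
    have hs := hconv.slope_mono_adjacent hp hy' hpx h
    have hlow : -K ≤ (f x - f (a / 2)) / (x - a / 2) := by
      rw [le_div_iff₀ (by linarith)]
      have hKa : K * (a / 2) = f (a / 2) - f 1 := by rw [hK]; field_simp
      have := hanti hx' h1 hx.2
      nlinarith [hx.1]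
    have h2 := hlow.trans hs
    rw [le_div_iff₀ (by linarith)] at h2
    rw [Real.dist_eq, abs_sub_comm, abs_of_pos (by linarith)]
    linarith

lemma AntitoneOn.deriv_nonpos_of_mem_Ioo {f : ℝ → ℝ} (hanti : AntitoneOn f (Icc (0 : ℝ) 1))
    {x : ℝ} (hx : x ∈ Ioo (0 : ℝ) 1) : deriv f x ≤ 0 := by
  rw [← derivWithin_of_mem_nhds (Icc_mem_nhds hx.1 hx.2)]
  exact hanti.derivWithin_nonpos

lemma intervalIntegrable_max_sub_abs_deriv (f : ℝ → ℝ) {t : ℝ} (ht : 0 < t) (a b : ℝ) :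
    IntervalIntegrable (fun x => max (t - |deriv f x|) 0) volume a b := by
  refine (intervalIntegrable_const (c := t)).mono_fun ?_ (Filter.Eventually.of_forall fun x => ?_)
  · have := measurable_deriv f
    exact (by fun_prop : Measurable fun x => max (t - |deriv f x|) 0).aestronglyMeasurable
  · simp only
    rw [Real.norm_of_nonneg (le_max_right _ _), Real.norm_of_nonneg ht.le]
    exact max_le (by linarith [abs_nonneg (deriv f x)]) ht.le

lemma integral_add_deriv_eq {f : ℝ → ℝ} {b t : ℝ} (h : AbsolutelyContinuousOnInterval f b 1) :
    ∫ x in b..1, (t + deriv f x) = t * (1 - b) - (f b - f 1) := by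
  rw [intervalIntegral.integral_add intervalIntegrable_const h.intervalIntegrable_deriv,
    h.integral_deriv_eq_sub, intervalIntegral.integral_const, smul_eq_mul]
  ring

lemma legendre_le_integral_max {f : ℝ → ℝ} (hconv : ConvexOn ℝ (Icc (0 : ℝ) 1) f)
    (hanti : AntitoneOn f (Icc (0 : ℝ) 1)) {t : ℝ} (ht : 0 < t) {a : ℝ} (ha : a ∈ Icc (0 : ℝ) 1) :
    t * (1 - a) - (f a - f 1) ≤ ∫ x in (0 : ℝ)..1, max (t - |deriv f x|) 0 := by
  have hpos : ∀ a : ℝ, 0 < a → a ≤ 1 →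
      t * (1 - a) - (f a - f 1) ≤ ∫ x in (0 : ℝ)..1, max (t - |deriv f x|) 0 := by
    intro a ha0 ha1
    have hac := hconv.absolutelyContinuousOnInterval_of_antitoneOn hanti ha0 ha1
    rw [← integral_add_deriv_eq hac]
    calc ∫ x in a..1, (t + deriv f x) ≤ ∫ x in a..1, max (t - |deriv f x|) 0 := by
          refine intervalIntegral.integral_mono_on_of_le_Ioo ha1
            (intervalIntegrable_const.add hac.intervalIntegrable_deriv)
            (intervalIntegrable_max_sub_abs_deriv f ht _ _) fun x hx => ?_
          rw [abs_of_nonpos (hanti.deriv_nonpos_of_mem_Ioo ⟨ha0.trans hx.1, hx.2⟩)]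
          exact le_max_of_le_left (by linarith)
      _ ≤ _ := intervalIntegral.integral_mono_interval ha0.le ha1 le_rfl
          (Filter.Eventually.of_forall fun x => le_max_right _ _)
          (intervalIntegrable_max_sub_abs_deriv f ht _ _)
  rcases ha.1.eq_or_lt with rfl | h
  · refine le_of_forall_pos_le_add fun ε hε => ?_
    have hδ : 0 < min 1 (ε / t) := by positivity
    have h1 := hpos _ hδ (min_le_left _ _)
    have h2 : f (min 1 (ε / t)) ≤ f 0 := hanti ha ⟨hδ.le, min_le_left _ _⟩ hδ.le
    have h3 : t * min 1 (ε / t) ≤ ε := by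
      calc t * min 1 (ε / t) ≤ t * (ε / t) := by gcongr; exact min_le_right _ _
        _ = ε := by field_simp
    linarith
  · exact hpos a h ha.2

lemma exists_integral_max_le_legendre {f : ℝ → ℝ} (hconv : ConvexOn ℝ (Icc (0 : ℝ) 1) f)
    (hanti : AntitoneOn f (Icc (0 : ℝ) 1)) {t : ℝ} (ht : 0 < t) {ε : ℝ} (hε : 0 < ε)
    (hε1 : ε ≤ 1) :
    ∃ b ∈ Icc (0 : ℝ) 1, ∫ x in (0 : ℝ)..1, max (t - |deriv f x|) 0 ≤
      t * (1 - b) - (f b - f 1) + t * ε := by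
  have hac := hconv.absolutelyContinuousOnInterval_of_antitoneOn hanti hε hε1
  have hcont : ContinuousOn (fun x => f x + t * x) (Icc ε 1) := by
    have := hac.continuousOn
    rw [uIcc_of_le hε1] at this
    fun_prop
  obtain ⟨b, hb, hmin⟩ := isCompact_Icc.exists_isMinOn (nonempty_Icc.2 hε1) hcont
  have hb0 : 0 < b := hε.trans_le hb.1
  have hbI : b ∈ Icc (0 : ℝ) 1 := ⟨hb0.le, hb.2⟩
  have hacb := hconv.absolutelyContinuousOnInterval_of_antitoneOn hanti hb0 hb.2
  have hint := intervalIntegrable_max_sub_abs_deriv f ht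
  have key : ∀ᵐ x, x ∈ Ioo ε 1 → 0 ≤ (t + deriv f x) * (x - b) := by
    filter_upwards [hac.ae_differentiableAt] with x hx hxI
    have hd := hx (by rw [uIcc_of_le hε1]; exact Ioo_subset_Icc_self hxI)
    have h1 := hconv.deriv_mul_sub_le ⟨hε.le.trans hxI.1.le, hxI.2.le⟩ hbI hd
    have h2 : f b + t * b ≤ f x + t * x := hmin (Ioo_subset_Icc_self hxI)
    linarith
  have hne : ∀ᵐ x : ℝ, x ≠ 1 ∧ x ≠ b := by
    filter_upwards [(finite_singleton (1 : ℝ)).countable.ae_notMem volume,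
      (finite_singleton b).countable.ae_notMem volume] with x h1 h2 using ⟨h1, h2⟩
  refine ⟨b, hbI, ?_⟩
  rw [← intervalIntegral.integral_add_adjacent_intervals (hint 0 ε) (hint ε 1),
    ← intervalIntegral.integral_add_adjacent_intervals (hint ε b) (hint b 1)]
  have I1 : ∫ x in (0 : ℝ)..ε, max (t - |deriv f x|) 0 ≤ t * ε := by
    calc _ ≤ ∫ x in (0 : ℝ)..ε, t :=
          intervalIntegral.integral_mono hε.le (hint _ _) intervalIntegrable_const fun x =>
            max_le (by linarith [abs_nonneg (deriv f x)]) ht.le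
      _ = t * ε := by simp [mul_comm]
  have I2 : ∫ x in ε..b, max (t - |deriv f x|) 0 = 0 := by
    refine intervalIntegral.integral_zero_ae ?_
    filter_upwards [key, hne] with x hx hxn hxI
    rw [uIoc_of_le hb.1] at hxI
    have hxb : x < b := lt_of_le_of_ne hxI.2 hxn.2
    have h := hx ⟨hxI.1, hxb.trans_le hb.2⟩
    have : t + deriv f x ≤ 0 := by
      by_contra! hc
      nlinarith
    rw [abs_of_nonpos (by linarith)]
    exact max_eq_right (by linarith)
  have I3 : ∫ x in b..1, max (t - |deriv f x|) 0 = t * (1 - b) - (f b - f 1) := by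
    rw [← integral_add_deriv_eq hacb]
    refine intervalIntegral.integral_congr_ae ?_
    filter_upwards [key, hne] with x hx hxn hxI
    rw [uIoc_of_le hb.2] at hxI
    have hx1 : x < 1 := lt_of_le_of_ne hxI.2 hxn.1
    have h := hx ⟨hb.1.trans_lt hxI.1, hx1⟩
    have : 0 ≤ t + deriv f x := nonneg_of_mul_nonneg_left h (by linarith [hxI.1])
    rw [abs_of_nonpos (hanti.deriv_nonpos_of_mem_Ioo ⟨hb0.trans hxI.1, hx1⟩)]
    rw [max_eq_left (by linarith)]
    ring
  linarith

section TradeOff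

variable {Ω : Type*} [MeasurableSpace Ω] {U V : Measure Ω} {φ : Ω → ℝ}

lemma integrable_of_mem_unitInterval {μ : Measure Ω} [IsProbabilityMeasure μ] (hφ : Measurable φ)
    (h01 : ∀ x, 0 ≤ φ x ∧ φ x ≤ 1) : Integrable φ μ :=
  Integrable.of_bound hφ.aestronglyMeasurable 1 (Filter.Eventually.of_forall fun x => by
    rw [Real.norm_of_nonneg (h01 x).1]; exact (h01 x).2)

lemma integral_mem_unitInterval {μ : Measure Ω} [IsProbabilityMeasure μ] (hφ : Measurable φ)
    (h01 : ∀ x, 0 ≤ φ x ∧ φ x ≤ 1) : ∫ x, φ x ∂μ ∈ Icc (0 : ℝ) 1 := by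
  refine ⟨integral_nonneg fun x => (h01 x).1, ?_⟩
  calc ∫ x, φ x ∂μ ≤ ∫ _, (1 : ℝ) ∂μ :=
        integral_mono (integrable_of_mem_unitInterval hφ h01) (integrable_const _)
          fun x => (h01 x).2
    _ = 1 := by simp

lemma tradeOff_nonneg [IsProbabilityMeasure V] (α : ℝ) : 0 ≤ tradeOff U V α := by
  refine Real.sInf_nonneg ?_
  rintro _ ⟨φ, hφ, h01, -, rfl⟩
  exact sub_nonneg.2 (integral_mem_unitInterval hφ h01).2

lemma tradeOff_le [IsProbabilityMeasure V] {α : ℝ} (hφ : Measurable φ) (h01 : ∀ x, 0 ≤ φ x ∧ φ x ≤ 1)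
    (hα : ∫ x, φ x ∂U ≤ α) : tradeOff U V α ≤ 1 - ∫ x, φ x ∂V := by
  refine csInf_le ⟨0, ?_⟩ ⟨φ, hφ, h01, hα, rfl⟩
  rintro _ ⟨φ, hφ, h01, -, rfl⟩
  exact sub_nonneg.2 (integral_mem_unitInterval hφ h01).2

lemma exists_lt_tradeOff_add {α ε : ℝ} (hα : 0 ≤ α) (hε : 0 < ε) :
    ∃ φ : Ω → ℝ, Measurable φ ∧ (∀ x, 0 ≤ φ x ∧ φ x ≤ 1) ∧ ∫ x, φ x ∂U ≤ α ∧
      1 - ∫ x, φ x ∂V < tradeOff U V α + ε := by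
  obtain ⟨_, ⟨φ, hφ, h01, h, rfl⟩, hlt⟩ := Real.lt_sInf_add_pos
    (s := { β : ℝ | ∃ φ : Ω → ℝ, Measurable φ ∧ (∀ x, 0 ≤ φ x ∧ φ x ≤ 1) ∧
      (∫ x, φ x ∂U) ≤ α ∧ β = 1 - ∫ x, φ x ∂V })
    ⟨1 - ∫ _, (0 : ℝ) ∂V, fun _ => 0, measurable_const, by simp, by simpa using hα, rfl⟩ hε
  exact ⟨φ, hφ, h01, h, hlt⟩

variable [IsProbabilityMeasure U] [IsProbabilityMeasure V]

lemma absolutelyContinuous_of_tradeOff_pos (h : ∀ α ∈ Ico (0 : ℝ) 1, 0 < tradeOff U V α) :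
    U ≪ V := by
  refine Measure.AbsolutelyContinuous.mk fun A hA hVA => ?_
  by_contra hUA
  have hU : 0 < U.real A := ENNReal.toReal_pos hUA (measure_ne_top _ _)
  have hφ : Measurable (Aᶜ.indicator fun _ : Ω => (1 : ℝ)) :=
    measurable_const.indicator hA.compl
  have h01 : ∀ x, 0 ≤ Aᶜ.indicator (fun _ : Ω => (1 : ℝ)) x ∧
      Aᶜ.indicator (fun _ : Ω => (1 : ℝ)) x ≤ 1 := fun x => by
    by_cases hx : x ∈ A <;> simp [hx]
  have hle := tradeOff_le (V := V) hφ h01 (le_refl (∫ x, Aᶜ.indicator (fun _ => (1 : ℝ)) x ∂U))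
  have hUI : ∫ x, Aᶜ.indicator (fun _ => (1 : ℝ)) x ∂U = 1 - U.real A := by
    rw [integral_indicator_const _ hA.compl, probReal_compl_eq_one_sub hA, smul_eq_mul, mul_one]
  have hVI : ∫ x, Aᶜ.indicator (fun _ => (1 : ℝ)) x ∂V = 1 := by
    rw [integral_indicator_const _ hA.compl, probReal_compl_eq_one_sub hA, smul_eq_mul, mul_one,
      measureReal_def, hVA]
    simp
  have hpos := h _ ⟨(integral_mem_unitInterval (μ := U) hφ h01).1, by linarith⟩
  linarith

lemma integral_mul_rnDeriv_sub_one (hUV : U ≪ V) (t : ℝ) (hφ : Measurable φ)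
    (h01 : ∀ x, 0 ≤ φ x ∧ φ x ≤ 1) :
    Integrable (fun x => φ x * (t * (U.rnDeriv V x).toReal - 1)) V ∧
      ∫ x, φ x * (t * (U.rnDeriv V x).toReal - 1) ∂V = t * ∫ x, φ x ∂U - ∫ x, φ x ∂V := by
  have hi : Integrable (fun x => (U.rnDeriv V x).toReal * φ x) V :=
    (integrable_rnDeriv_smul_iff hUV).2 (integrable_of_mem_unitInterval hφ h01)
  have hV := integrable_of_mem_unitInterval (μ := V) hφ h01
  have heq : (fun x => φ x * (t * (U.rnDeriv V x).toReal - 1)) =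
      fun x => t * ((U.rnDeriv V x).toReal * φ x) - φ x := by
    ext x; ring
  rw [heq]
  refine ⟨(hi.const_mul t).sub hV, ?_⟩
  rw [integral_sub (hi.const_mul t) hV, integral_const_mul, integral_toReal_rnDeriv_mul hUV]

lemma integrable_max_rnDeriv_sub_one (t : ℝ) :
    Integrable (fun x => max (t * (U.rnDeriv V x).toReal - 1) 0) V :=
  ((Measure.integrable_toReal_rnDeriv.const_mul t).sub (integrable_const 1)).pos_part

lemma legendre_tradeOff_le (hUV : U ≪ V) {t : ℝ} (ht : 0 < t) {α : ℝ} (hα : 0 ≤ α) :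
    t * (1 - α) - tradeOff U V α ≤ ∫ x, max (t * (U.rnDeriv V x).toReal - 1) 0 ∂V := by
  refine le_of_forall_pos_le_add fun ε hε => ?_
  obtain ⟨φ, hφ, h01, hU, hV⟩ := exists_lt_tradeOff_add (U := U) (V := V) hα hε
  have hψ : Measurable fun x => 1 - φ x := by fun_prop
  have hψ01 : ∀ x, 0 ≤ 1 - φ x ∧ 1 - φ x ≤ 1 := fun x =>
    ⟨by linarith [(h01 x).2], by linarith [(h01 x).1]⟩
  obtain ⟨hi, heq⟩ := integral_mul_rnDeriv_sub_one hUV t hψ hψ01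
  have hle : ∫ x, (1 - φ x) * (t * (U.rnDeriv V x).toReal - 1) ∂V ≤
      ∫ x, max (t * (U.rnDeriv V x).toReal - 1) 0 ∂V := by
    refine integral_mono hi (integrable_max_rnDeriv_sub_one t) fun x => ?_
    rcases le_total (t * (U.rnDeriv V x).toReal - 1) 0 with h | h
    · exact le_max_of_le_right (mul_nonpos_of_nonneg_of_nonpos (hψ01 x).1 h)
    · exact le_max_of_le_left (mul_le_of_le_one_left h (hψ01 x).2)
  rw [heq, integral_sub (integrable_const _) (integrable_of_mem_unitInterval hφ h01),
    integral_sub (integrable_const _) (integrable_of_mem_unitInterval hφ h01)] at hle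
  simp only [integral_const, probReal_univ, smul_eq_mul, mul_one] at hle
  have := mul_le_mul_of_nonneg_left hU ht.le
  linarith

lemma exists_le_legendre_tradeOff (hUV : U ≪ V) (t : ℝ) :
    ∃ α ∈ Icc (0 : ℝ) 1, ∫ x, max (t * (U.rnDeriv V x).toReal - 1) 0 ∂V ≤
      t * (1 - α) - tradeOff U V α := by
  set A : Set Ω := {x | 0 < t * (U.rnDeriv V x).toReal - 1} with hA
  have hAm : MeasurableSet A := by
    have := Measure.measurable_rnDeriv U V
    exact measurableSet_lt (by fun_prop) (by fun_prop)
  have hψ : Measurable (A.indicator fun _ : Ω => (1 : ℝ)) := measurable_const.indicator hAm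
  have hψ01 : ∀ x, 0 ≤ A.indicator (fun _ : Ω => (1 : ℝ)) x ∧
      A.indicator (fun _ : Ω => (1 : ℝ)) x ≤ 1 := fun x => by
    by_cases hx : x ∈ A <;> simp [hx]
  obtain ⟨-, heq⟩ := integral_mul_rnDeriv_sub_one hUV t hψ hψ01
  have hφ : Measurable fun x => 1 - A.indicator (fun _ : Ω => (1 : ℝ)) x := by fun_prop
  have hφ01 : ∀ x, 0 ≤ 1 - A.indicator (fun _ : Ω => (1 : ℝ)) x ∧
      1 - A.indicator (fun _ : Ω => (1 : ℝ)) x ≤ 1 := fun x =>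
    ⟨by linarith [(hψ01 x).2], by linarith [(hψ01 x).1]⟩
  refine ⟨_, integral_mem_unitInterval (μ := U) hφ hφ01, ?_⟩
  have hle := tradeOff_le (U := U) (V := V) hφ hφ01 le_rfl
  have hmax : ∫ x, max (t * (U.rnDeriv V x).toReal - 1) 0 ∂V =
      ∫ x, A.indicator (fun _ => (1 : ℝ)) x * (t * (U.rnDeriv V x).toReal - 1) ∂V := by
    refine integral_congr_ae (Filter.Eventually.of_forall fun x => ?_)
    by_cases hx : x ∈ A
    · simp only [indicator_of_mem hx, one_mul]
      exact max_eq_left (le_of_lt hx)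
    · simp only [indicator_of_notMem hx, zero_mul]
      exact max_eq_right (not_lt.1 hx)
  have hone : ∀ μ : Measure Ω, IsProbabilityMeasure μ →
      ∫ x, (1 - A.indicator (fun _ : Ω => (1 : ℝ)) x) ∂μ =
        1 - ∫ x, A.indicator (fun _ : Ω => (1 : ℝ)) x ∂μ := fun μ _ => by
    rw [integral_sub (integrable_const _) (integrable_of_mem_unitInterval hψ hψ01)]
    simp
  rw [hmax, heq]
  rw [hone V inferInstance] at hle
  rw [hone U inferInstance] at hle ⊢
  linarith

lemma integral_max_deriv_eq_integral_max_rnDeriv {f : ℝ → ℝ}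
    (hconv : ConvexOn ℝ (Icc (0 : ℝ) 1) f) (hanti : AntitoneOn f (Icc (0 : ℝ) 1))
    (hf1 : f 1 = 0) (hT : ∀ α ∈ Icc (0 : ℝ) 1, tradeOff U V α = f α) (hUV : U ≪ V)
    {t : ℝ} (ht : 0 < t) :
    ∫ x in (0 : ℝ)..1, max (t - |deriv f x|) 0 =
      ∫ x, max (t * (U.rnDeriv V x).toReal - 1) 0 ∂V := by
  apply le_antisymm
  · refine le_of_forall_pos_le_add fun ε hε => ?_
    have hδ : 0 < min 1 (ε / t) := by positivity
    obtain ⟨b, hb, hle⟩ := exists_integral_max_le_legendre hconv hanti ht hδ (min_le_left _ _)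
    have h3 : t * min 1 (ε / t) ≤ ε := by
      calc t * min 1 (ε / t) ≤ t * (ε / t) := by gcongr; exact min_le_right _ _
        _ = ε := by field_simp
    have := legendre_tradeOff_le hUV ht hb.1
    rw [hT b hb] at this
    linarith
  · obtain ⟨α, hα, hle⟩ := exists_le_legendre_tradeOff hUV t
    have := legendre_le_integral_max hconv hanti ht hα
    rw [hT α hα] at hle
    linarith

lemma lintegral_deriv_rpow_eq_lintegral_rnDeriv_rpow {f : ℝ → ℝ}
    (hconv : ConvexOn ℝ (Icc (0 : ℝ) 1) f) (hanti : AntitoneOn f (Icc (0 : ℝ) 1))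
    (hf1 : f 1 = 0) (hpos : ∀ x ∈ Ico (0 : ℝ) 1, 0 < f x)
    (hT : ∀ α ∈ Icc (0 : ℝ) 1, tradeOff U V α = f α) (hUV : U ≪ V) {l : ℝ} (hl : 1 < l) :
    ∫⁻ x in Ioc (0 : ℝ) 1, ENNReal.ofReal (|deriv f x| ^ (1 - l)) =
      ∫⁻ x, ENNReal.ofReal ((U.rnDeriv V x).toReal ^ l) ∂V := by
  obtain ⟨s, hs, rfl⟩ : ∃ s, 0 < s ∧ l = s + 1 := ⟨l - 1, by linarith, by ring⟩
  have hdm := measurable_deriv f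
  have hrm := Measure.measurable_rnDeriv U V
  have hneg : ∀ᵐ x ∂volume.restrict (Ioc (0 : ℝ) 1), 0 < |deriv f x| := by
    have hne : ∀ᵐ x : ℝ, x ≠ 1 := (finite_singleton (1 : ℝ)).countable.ae_notMem volume
    have hd : ∀ n : ℕ, ∀ᵐ x, x ∈ uIcc (1 / (n + 1 : ℝ)) 1 → DifferentiableAt ℝ f x := fun n =>
      (hconv.absolutelyContinuousOnInterval_of_antitoneOn hanti Nat.one_div_pos_of_nat
        (Nat.one_div_le_one_div n.zero_le |>.trans (by simp))).ae_differentiableAt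
    rw [ae_restrict_iff' measurableSet_Ioc]
    filter_upwards [hne, ae_all_iff.2 hd] with x hx1 hxd hx
    have hxlt : x < 1 := lt_of_le_of_ne hx.2 hx1
    obtain ⟨n, hn⟩ := exists_nat_one_div_lt hx.1
    have hdx := hxd n (by rw [uIcc_of_le (hn.le.trans hx.2)]; exact ⟨hn.le, hx.2⟩)
    have h1 := hconv.deriv_mul_sub_le ⟨hx.1.le, hx.2⟩ (by simp : (1 : ℝ) ∈ Icc (0 : ℝ) 1) hdx
    have h2 := hpos x ⟨hx.1.le, hxlt⟩
    refine abs_pos.2 fun h0 => ?_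
    rw [h0, hf1] at h1
    linarith
  calc ∫⁻ x in Ioc (0 : ℝ) 1, ENNReal.ofReal (|deriv f x| ^ (1 - (s + 1)))
      = ∫⁻ x in Ioc (0 : ℝ) 1, ∫⁻ t in Ioi (0 : ℝ),
          ENNReal.ofReal (s * (s + 1) * t ^ (-s - 2)) * ENNReal.ofReal (t - |deriv f x|) := by
        refine lintegral_congr_ae ?_
        filter_upwards [hneg] with x hx
        rw [lintegral_Ioi_rpow_mul_ofReal_sub hs hx]
        congr 2
        ring
    _ = ∫⁻ t in Ioi (0 : ℝ), ∫⁻ x in Ioc (0 : ℝ) 1,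
          ENNReal.ofReal (s * (s + 1) * t ^ (-s - 2)) * ENNReal.ofReal (t - |deriv f x|) :=
        lintegral_lintegral_swap (by fun_prop)
    _ = ∫⁻ t in Ioi (0 : ℝ), ∫⁻ x, ENNReal.ofReal (s * (s + 1) * t ^ (-s - 2)) *
          ENNReal.ofReal (t * (U.rnDeriv V x).toReal - 1) ∂V := by
        refine setLIntegral_congr_fun measurableSet_Ioi fun t ht => ?_
        rw [lintegral_const_mul _ (by fun_prop), lintegral_const_mul _ (by fun_prop)]
        congr 1
        have h := integral_max_deriv_eq_integral_max_rnDeriv hconv hanti hf1 hT hUV ht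
        rw [intervalIntegral.integral_of_le zero_le_one] at h
        have h' := congrArg ENNReal.ofReal h
        rw [ofReal_integral_eq_lintegral_ofReal (intervalIntegrable_max_sub_abs_deriv f ht 0 1).1
            (Filter.Eventually.of_forall fun x => le_max_right _ _),
          ofReal_integral_eq_lintegral_ofReal (integrable_max_rnDeriv_sub_one t)
            (Filter.Eventually.of_forall fun x => le_max_right _ _)] at h'
        simpa only [ENNReal.ofReal_max, ENNReal.ofReal_zero, max_zero] using h'
    _ = ∫⁻ x, (∫⁻ t in Ioi (0 : ℝ), ENNReal.ofReal (s * (s + 1) * t ^ (-s - 2)) *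
          ENNReal.ofReal (t * (U.rnDeriv V x).toReal - 1)) ∂V :=
        lintegral_lintegral_swap (by fun_prop)
    _ = ∫⁻ x, ENNReal.ofReal ((U.rnDeriv V x).toReal ^ (s + 1)) ∂V := by
        refine lintegral_congr fun x => ?_
        generalize hr : (U.rnDeriv V x).toReal = r
        have hr0 : 0 ≤ r := hr ▸ ENNReal.toReal_nonneg
        rcases hr0.eq_or_lt with rfl | hr0
        · simp [Real.zero_rpow (by linarith : s + 1 ≠ 0), ENNReal.ofReal_of_nonpos]
        have hfac : ∀ t : ℝ, ENNReal.ofReal (s * (s + 1) * t ^ (-s - 2)) *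
            ENNReal.ofReal (t * r - 1) = ENNReal.ofReal r *
              (ENNReal.ofReal (s * (s + 1) * t ^ (-s - 2)) * ENNReal.ofReal (t - r⁻¹)) := by
          intro t
          rw [mul_left_comm, ← ENNReal.ofReal_mul hr0.le, mul_sub, mul_inv_cancel₀ hr0.ne',
            mul_comm r t]
        simp_rw [hfac]
        rw [lintegral_const_mul _ (by fun_prop), lintegral_Ioi_rpow_mul_ofReal_sub hs (by positivity),
          ← ENNReal.ofReal_mul hr0.le, Real.inv_rpow hr0.le, Real.rpow_neg hr0.le, inv_inv,
          Real.rpow_add_one hr0.ne', mul_comm]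

end TradeOff

/-- Conversion from `f`-DP to Rényi differential privacy (Dong–Roth–Su): if `f = T(U,V)` is a
trade-off function with `inf{x : f x = 0} = 1`, then
`D^λ(U‖V) ≤ (1/(λ-1)) log ∫₀¹ |f'(x)|^{1-λ} dx`. -/
theorem renyiDiv_le_of_tradeOff {Ω : Type*} [MeasurableSpace Ω]
    (U V : Measure Ω) [IsProbabilityMeasure U] [IsProbabilityMeasure V]
    (f : ℝ → ℝ)
    (hconv : ConvexOn ℝ (Icc (0:ℝ) 1) f)
    (hanti : AntitoneOn f (Icc (0:ℝ) 1))
    (hle : ∀ x ∈ Icc (0:ℝ) 1, f x ≤ 1 - x)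
    (hinf : sInf {x ∈ Icc (0:ℝ) 1 | f x = 0} = 1)
    (hT : ∀ α ∈ Icc (0:ℝ) 1, tradeOff U V α = f α)
    (l : ℝ) (hl : 1 < l) :
    renyiDiv l U V ≤ (l - 1)⁻¹ * Real.log (∫ x in (0:ℝ)..1, |deriv f x| ^ (1 - l)) := by
  have hf1 : f 1 = 0 := by
    have h1 : (1 : ℝ) ∈ Icc (0 : ℝ) 1 := by simp
    refine le_antisymm (by simpa using hle 1 h1) ?_
    rw [← hT 1 h1]
    exact tradeOff_nonneg 1
  have hpos : ∀ x ∈ Ico (0 : ℝ) 1, 0 < f x := by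
    intro x hx
    have hxI : x ∈ Icc (0 : ℝ) 1 := Ico_subset_Icc_self hx
    have h0 : 0 ≤ f x := hT x hxI ▸ tradeOff_nonneg x
    refine h0.lt_of_ne fun h => ?_
    have : sInf {x ∈ Icc (0 : ℝ) 1 | f x = 0} ≤ x := csInf_le ⟨0, fun y hy => hy.1.1⟩ ⟨hxI, h.symm⟩
    linarith [hx.2]
  have hUV : U ≪ V := absolutelyContinuous_of_tradeOff_pos fun α hα => by
    rw [hT α (Ico_subset_Icc_self hα)]
    exact hpos α hα
  have hdm := measurable_deriv f
  have hrm := Measure.measurable_rnDeriv U V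
  rw [renyiDiv, intervalIntegral.integral_of_le zero_le_one,
    integral_eq_lintegral_of_nonneg_ae (Filter.Eventually.of_forall fun x => by positivity)
      (hrm.ennreal_toReal.pow_const l).aestronglyMeasurable,
    integral_eq_lintegral_of_nonneg_ae (Filter.Eventually.of_forall fun x => by positivity)
      (hdm.abs.pow_const (1 - l)).aestronglyMeasurable,
    lintegral_deriv_rpow_eq_lintegral_rnDeriv_rpow hconv hanti hf1 hpos hT hUV hl]
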